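/- arXiv:2403.00585 — 6 statements merged into one kernel-verified Lean document; each statement's English description precedes it below -/
import Mathlib

section
/- Suppose n* ∈ {1,…,N} satisfies conditions (10b) and (10c). Then L_{n*}/S_{n*} is the optimal computation time of the decentralized uncoded storage elastic computing problem: every feasible computation assignment μ satisfies c(μ) ≥ L_{n*}/S_{n*}, and there exists a feasible computation assignment μ with c(μ) = L_{n*}/S_{n*}. -/
open Finset

/-- A feasible computation assignment: `μ n V` is the (normalized) amount of the
datasets stored exactly by the machines in `V` that is computed by machine `n`.
All entries are nonnegative, `μ n V = 0` when `n ∉ V`, and every nonempty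
subset `V` of `{1,…,N}` has its whole load `a V` computed. -/
def Feasible (N : ℕ) (a : Finset ℕ → ℝ) (μ : ℕ → Finset ℕ → ℝ) : Prop :=
  (∀ n V, 0 ≤ μ n V) ∧
  (∀ n V, n ∉ V → μ n V = 0) ∧
  (∀ V : Finset ℕ, V ⊆ Finset.Icc 1 N → V.Nonempty → ∑ n ∈ V, μ n V = a V)

/-- The computation time of an assignment: the largest, over machines
`n ∈ {1,…,N}`, of the total load of machine `n` divided by its speed. -/
noncomputable def compTime (N : ℕ) (hN : 1 ≤ N) (s : ℕ → ℝ)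
    (μ : ℕ → Finset ℕ → ℝ) : ℝ :=
  (Finset.Icc 1 N).sup' (Finset.nonempty_Icc.mpr hN) fun n =>
    (∑ V ∈ (Finset.Icc 1 N).powerset, μ n V) / s n

/-- total load of the subsets of `A` -/
lemma total_load {N : ℕ} {α β : ℝ} {a : Finset ℕ → ℝ}
    (ha : ∀ V : Finset ℕ, a V = β * (α - 1) ^ V.card)
    {μ : ℕ → Finset ℕ → ℝ} (hμ : Feasible N a μ) (A : Finset ℕ) (hA : A ⊆ Finset.Icc 1 N) :
    ∑ n ∈ A, ∑ V ∈ A.powerset, μ n V = β * (α ^ A.card - 1) := by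
  obtain ⟨h0, hz, hsum⟩ := hμ
  rw [Finset.sum_comm]
  have h1 : ∀ V ∈ A.powerset, ∑ n ∈ A, μ n V = a V - if V = ∅ then β else 0 := by
    intro V hV
    rw [Finset.mem_powerset] at hV
    rw [← Finset.sum_subset hV (fun n _ hn => hz n V hn)]
    by_cases hE : V = ∅
    · subst hE
      simp [ha]
    · rw [hsum V (hV.trans hA) (Finset.nonempty_iff_ne_empty.mpr hE)]
      simp [hE]
  rw [Finset.sum_congr rfl h1, Finset.sum_sub_distrib]
  have h2 := Finset.sum_pow_mul_eq_add_pow (α - 1) 1 A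
  simp only [one_pow, mul_one, sub_add_cancel] at h2
  simp only [ha]
  rw [← Finset.mul_sum, h2]
  simp
  ring

lemma sum_speed_le {N : ℕ} {s : ℕ → ℝ}
    (hs_mono : ∀ i j : ℕ, 1 ≤ i → i ≤ j → j ≤ N → s i ≤ s j) (A : Finset ℕ) :
    A ⊆ Finset.Icc 1 N → ∑ i ∈ Finset.Icc 1 A.card, s i ≤ ∑ i ∈ A, s i := by
  induction A using Finset.induction_on_max with
  | empty => simp
  | insert m B hB ih =>
    intro hA
    have hm : m ∉ B := fun h => lt_irrefl _ (hB m h)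
    rw [Finset.card_insert_of_notMem hm, Finset.sum_insert hm,
      Finset.sum_Icc_succ_top (by omega)]
    have h1 := ih ((Finset.subset_insert _ _).trans hA)
    have h2 : insert m B ⊆ Finset.Icc 1 m := by
      intro x hx
      have := Finset.mem_Icc.mp (hA hx)
      rw [Finset.mem_insert] at hx
      rw [Finset.mem_Icc]
      rcases hx with rfl | hx
      · omega
      · have := hB x hx
        omega
    have h3 := Finset.card_le_card h2
    rw [Finset.card_insert_of_notMem hm, Nat.card_Icc] at h3
    have h4 := Finset.mem_Icc.mp (hA (Finset.mem_insert_self m B))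
    have := hs_mono (B.card + 1) m (by omega) (by omega) h4.2
    linarith

/-- the quadratic objective -/
noncomputable def objective (N : ℕ) (s : ℕ → ℝ) (μ : ℕ → Finset ℕ → ℝ) : ℝ :=
  ∑ n ∈ Finset.Icc 1 N, (∑ V ∈ (Finset.Icc 1 N).powerset, μ n V) ^ 2 / s n

lemma exists_minimizer (N : ℕ) (s : ℕ → ℝ) (a : Finset ℕ → ℝ) (ha : ∀ V, 0 ≤ a V) :
    ∃ μ, Feasible N a μ ∧ (∀ n V, ¬ V ⊆ Finset.Icc 1 N → μ n V = 0) ∧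
      ∀ ν, Feasible N a ν → (∀ n V, ¬ V ⊆ Finset.Icc 1 N → ν n V = 0) →
      objective N s μ ≤ objective N s ν := by
  classical
  set F : Set (ℕ → Finset ℕ → ℝ) :=
    {μ | Feasible N a μ ∧ ∀ n V, ¬ V ⊆ Finset.Icc 1 N → μ n V = 0} with hF
  have hne : F.Nonempty := by
    refine ⟨fun n V => if n ∈ V ∧ V ⊆ Finset.Icc 1 N then a V / V.card else 0,
      ⟨?_, ?_, ?_⟩, ?_⟩
    · intro n V
      dsimp only
      split_ifs
      · exact div_nonneg (ha V) (Nat.cast_nonneg _)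
      · exact le_rfl
    · intro n V hn
      simp [hn]
    · intro V hV hne
      have : ∀ n ∈ V, (if n ∈ V ∧ V ⊆ Finset.Icc 1 N then a V / V.card else 0)
          = a V / V.card := by
        intro n hn
        rw [if_pos ⟨hn, hV⟩]
      rw [Finset.sum_congr rfl this, Finset.sum_const, nsmul_eq_mul]
      have : (V.card : ℝ) ≠ 0 := by
        exact_mod_cast (Finset.card_pos.mpr hne).ne'
      field_simp
    · intro n V hV
      simp [hV]
  have hbox : IsCompact (Set.pi Set.univ fun _ : ℕ =>
      Set.pi Set.univ fun V : Finset ℕ => Set.Icc (0 : ℝ) (a V)) :=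
    isCompact_univ_pi fun _ => isCompact_univ_pi fun V => isCompact_Icc
  have hclosed : IsClosed F := by
    have : F = (⋂ n, ⋂ V, {μ : ℕ → Finset ℕ → ℝ | 0 ≤ μ n V}) ∩
        (⋂ n, ⋂ V, ⋂ (_ : n ∉ V), {μ : ℕ → Finset ℕ → ℝ | μ n V = 0}) ∩
        (⋂ V, ⋂ (_ : V ⊆ Finset.Icc 1 N), ⋂ (_ : V.Nonempty),
          {μ : ℕ → Finset ℕ → ℝ | ∑ n ∈ V, μ n V = a V}) ∩
        (⋂ n, ⋂ V, ⋂ (_ : ¬ V ⊆ Finset.Icc 1 N), {μ : ℕ → Finset ℕ → ℝ | μ n V = 0}) := by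
      ext μ
      simp only [hF, Feasible, Set.mem_ofPred_eq, Set.mem_inter_iff, Set.mem_iInter]
      tauto
    rw [this]
    refine ((IsClosed.inter ?_ ?_).inter ?_).inter ?_
    · exact isClosed_iInter fun n => isClosed_iInter fun V =>
        isClosed_le (by fun_prop) (by fun_prop)
    · exact isClosed_iInter fun n => isClosed_iInter fun V => isClosed_iInter fun _ =>
        isClosed_eq (by fun_prop) (by fun_prop)
    · exact isClosed_iInter fun n => isClosed_iInter fun V => isClosed_iInter fun _ =>
        isClosed_eq (by fun_prop) (by fun_prop)
    · exact isClosed_iInter fun n => isClosed_iInter fun V => isClosed_iInter fun _ =>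
        isClosed_eq (by fun_prop) (by fun_prop)
  have hsub : F ⊆ (Set.pi Set.univ fun _ : ℕ =>
      Set.pi Set.univ fun V : Finset ℕ => Set.Icc (0 : ℝ) (a V)) := by
    rintro μ ⟨⟨h0, hz, hsum⟩, hout⟩ n _ V _
    refine ⟨h0 n V, ?_⟩
    by_cases hn : n ∈ V
    · by_cases hV : V ⊆ Finset.Icc 1 N
      · rw [← hsum V hV ⟨n, hn⟩]
        exact Finset.single_le_sum (f := fun n => μ n V) (fun i _ => h0 i V) hn
      · rw [hout n V hV]
        exact ha V
    · rw [hz n V hn]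
      exact ha V
  have hcomp : IsCompact F := hbox.of_isClosed_subset hclosed hsub
  have hcont : Continuous (objective N s) := by
    unfold objective
    simp only [div_eq_mul_inv]
    fun_prop
  obtain ⟨μ, hμ, hmin⟩ := hcomp.exists_isMinOn hne hcont.continuousOn
  exact ⟨μ, hμ.1, hμ.2, fun ν h1 h2 => hmin ⟨h1, h2⟩⟩

lemma balanced {N : ℕ} {s : ℕ → ℝ} {a : Finset ℕ → ℝ} (hs_pos : ∀ i ∈ Finset.Icc 1 N, 0 < s i)
    {μ : ℕ → Finset ℕ → ℝ} (hμ : Feasible N a μ)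
    (hout : ∀ n V, ¬ V ⊆ Finset.Icc 1 N → μ n V = 0)
    (hmin : ∀ ν, Feasible N a ν → (∀ n V, ¬ V ⊆ Finset.Icc 1 N → ν n V = 0) →
      objective N s μ ≤ objective N s ν)
    {V : Finset ℕ} (hV : V ⊆ Finset.Icc 1 N) {n m : ℕ} (hn : n ∈ V) (hm : m ∈ V)
    (hpos : 0 < μ n V) :
    (∑ W ∈ (Finset.Icc 1 N).powerset, μ n W) / s n ≤
      (∑ W ∈ (Finset.Icc 1 N).powerset, μ m W) / s m := by
  classical
  by_contra! hlt
  have hnm : n ≠ m := by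
    rintro rfl
    exact lt_irrefl _ hlt
  set x : ℕ → ℝ := fun k => ∑ W ∈ (Finset.Icc 1 N).powerset, μ k W with hx
  change x m / s m < x n / s n at hlt
  have hsn := hs_pos n (hV hn)
  have hsm := hs_pos m (hV hm)
  set q : ℝ := 1 / s n + 1 / s m with hq
  have hqpos : 0 < q := by positivity
  set D : ℝ := x n / s n - x m / s m with hD
  have hDpos : 0 < D := sub_pos.mpr hlt
  set ε : ℝ := min (μ n V) (D / q) with hε
  have hεpos : 0 < ε := lt_min hpos (div_pos hDpos hqpos)
  have hε1 : ε ≤ μ n V := min_le_left _ _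
  have hε2 : ε * q ≤ D := by
    rw [← le_div_iff₀ hqpos]
    exact min_le_right _ _
  set d : ℕ → ℝ := fun k => (if k = m then 1 else 0) - (if k = n then 1 else 0) with hd
  set ν : ℕ → Finset ℕ → ℝ := fun k W => μ k W + if W = V then ε * d k else 0 with hν
  obtain ⟨h0, hz, hsum⟩ := hμ
  have hνF : Feasible N a ν := by
    refine ⟨?_, ?_, ?_⟩
    · intro k W
      have h := h0 k W
      simp only [hν, hd]
      by_cases hW : W = V
      · subst hW
        by_cases h1 : k = m
        · have h2 : k ≠ n := fun h => hnm (h.symm.trans h1)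
          simp [h1, hnm.symm]
          have := h0 m W
          linarith
        · by_cases h2 : k = n
          · subst h2
            simp [hnm]
            linarith
          · simp [h1, h2, h]
      · simp [hW, h]
    · intro k W hk
      simp only [hν, hd, hz k W hk]
      by_cases hW : W = V
      · subst hW
        have h1 : k ≠ m := fun h => hk (h ▸ hm)
        have h2 : k ≠ n := fun h => hk (h ▸ hn)
        simp [h1, h2]
      · simp [hW]
    · intro W hW hne
      simp only [hν]
      rw [Finset.sum_add_distrib, hsum W hW hne]
      by_cases hWV : W = V
      · subst hWV
        simp [hd, ← Finset.mul_sum, Finset.sum_sub_distrib, hn, hm]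
      · simp [hWV]
  have hνout : ∀ k W, ¬ W ⊆ Finset.Icc 1 N → ν k W = 0 := by
    intro k W hW
    have : W ≠ V := fun h => hW (h ▸ hV)
    simp [hν, this, hout k W hW]
  have hle := hmin ν hνF hνout
  have hxν : ∀ k, ∑ W ∈ (Finset.Icc 1 N).powerset, ν k W = x k + ε * d k := by
    intro k
    simp only [hν]
    rw [Finset.sum_add_distrib, Finset.sum_ite_eq', if_pos (Finset.mem_powerset.mpr hV)]
  have hexp : objective N s ν = objective N s μ
      + ((2 * ε * x m / s m + ε ^ 2 / s m) + (- (2 * ε * x n / s n) + ε ^ 2 / s n)) := by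
    unfold objective
    have h1 : ∀ k ∈ Finset.Icc 1 N, (∑ W ∈ (Finset.Icc 1 N).powerset, ν k W) ^ 2 / s k
        = (∑ W ∈ (Finset.Icc 1 N).powerset, μ k W) ^ 2 / s k
        + ((if k = m then 2 * ε * x k / s k + ε ^ 2 / s k else 0)
        + (if k = n then - (2 * ε * x k / s k) + ε ^ 2 / s k else 0)) := by
      intro k _
      rw [hxν]
      change _ = x k ^ 2 / s k + _
      simp only [hd]
      by_cases h1 : k = m
      · have h2 : k ≠ n := fun h => hnm (h.symm.trans h1)
        rw [if_pos h1, if_neg h2, if_pos h1, if_neg h2]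
        ring
      · by_cases h2 : k = n
        · rw [if_neg h1, if_pos h2, if_neg h1, if_pos h2]
          ring
        · rw [if_neg h1, if_neg h2, if_neg h1, if_neg h2]
          ring
    rw [Finset.sum_congr rfl h1, Finset.sum_add_distrib, Finset.sum_add_distrib,
      Finset.sum_ite_eq', Finset.sum_ite_eq', if_pos (hV hn), if_pos (hV hm)]
  rw [hexp] at hle
  have : (2 * ε * x m / s m + ε ^ 2 / s m) + (- (2 * ε * x n / s n) + ε ^ 2 / s n)
      = ε * (ε * q - 2 * D) := by
    rw [hq, hD]
    ring
  rw [this] at hle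
  have : ε * (ε * q - 2 * D) < 0 := mul_neg_of_pos_of_neg hεpos (by linarith)
  linarith

/-- If `n*` satisfies conditions (10b) and (10c), then `L n* / S n*` is the optimal
computation time: it lower bounds the computation time of every feasible assignment,
and it is achieved by some feasible assignment. -/
theorem optimal_computation_time
    (N : ℕ) (hN : 1 ≤ N) (α β : ℝ) (hα : 1 < α) (hβ : β = (α ^ N)⁻¹)
    (s : ℕ → ℝ) (hs_pos : ∀ i ∈ Finset.Icc 1 N, 0 < s i)
    (hs_mono : ∀ i j : ℕ, 1 ≤ i → i ≤ j → j ≤ N → s i ≤ s j)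
    (a : Finset ℕ → ℝ) (ha : ∀ V : Finset ℕ, a V = β * (α - 1) ^ V.card)
    (L S : ℕ → ℝ) (hL : ∀ n, L n = β * (α ^ n - 1))
    (hS : ∀ n, S n = ∑ i ∈ Finset.Icc 1 n, s i)
    (nstar : ℕ) (hn1 : 1 ≤ nstar) (hn2 : nstar ≤ N)
    (h10b : ∀ n, nstar < n → n ≤ N →
      (L n - L nstar) / (S n - S nstar) ≤ L nstar / S nstar)
    (h10c : ∀ n, 1 ≤ n → n < nstar → L n / S n ≤ L nstar / S nstar) :
    (∀ μ : ℕ → Finset ℕ → ℝ, Feasible N a μ →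
        L nstar / S nstar ≤ compTime N hN s μ) ∧
    (∃ μ : ℕ → Finset ℕ → ℝ, Feasible N a μ ∧
        compTime N hN s μ = L nstar / S nstar) := by
  classical
  have hSpos : ∀ n, 1 ≤ n → n ≤ N → 0 < S n := by
    intro n h1 h2
    rw [hS]
    refine Finset.sum_pos (fun i hi => hs_pos i ?_) (Finset.nonempty_Icc.mpr h1)
    rw [Finset.mem_Icc] at hi ⊢
    omega
  have hβpos : 0 < β := by
    rw [hβ]
    positivity
  have hlower : ∀ μ : ℕ → Finset ℕ → ℝ, Feasible N a μ →
        L nstar / S nstar ≤ compTime N hN s μ := by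
    intro μ hμ
    rw [div_le_iff₀ (hSpos nstar hn1 hn2), hL, hS]
    have hsub : Finset.Icc 1 nstar ⊆ Finset.Icc 1 N := Finset.Icc_subset_Icc le_rfl hn2
    have h := total_load ha hμ (Finset.Icc 1 nstar) hsub
    rw [Nat.card_Icc, Nat.add_sub_cancel] at h
    rw [← h, Finset.mul_sum]
    refine Finset.sum_le_sum fun n hn => ?_
    calc ∑ V ∈ (Finset.Icc 1 nstar).powerset, μ n V
        ≤ ∑ V ∈ (Finset.Icc 1 N).powerset, μ n V :=
          Finset.sum_le_sum_of_subset_of_nonneg (Finset.powerset_mono.mpr hsub)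
            fun V _ _ => hμ.1 n V
      _ ≤ compTime N hN s μ * s n := by
          rw [← div_le_iff₀ (hs_pos n (hsub hn))]
          exact Finset.le_sup' (fun n => (∑ V ∈ (Finset.Icc 1 N).powerset, μ n V) / s n)
            (hsub hn)
  refine ⟨hlower, ?_⟩
  have hLS : ∀ n, 1 ≤ n → n ≤ N → L n ≤ L nstar / S nstar * S n := by
    intro n h1 h2
    rcases lt_trichotomy n nstar with h | h | h
    · rw [← div_le_iff₀ (hSpos n h1 h2)]
      exact h10c n h1 h
    · subst h
      rw [div_mul_cancel₀ _ (hSpos n h1 h2).ne']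
    · have h3 := h10b n h h2
      have h4 : 0 < S n - S nstar := by
        rw [sub_pos, hS, hS]
        refine Finset.sum_lt_sum_of_subset (Finset.Icc_subset_Icc le_rfl h.le)
          (i := n) (by simp; omega) (by simp; omega) (hs_pos n (by simp; omega)) ?_
        intro j hj _
        refine (hs_pos j ?_).le
        rw [Finset.mem_Icc] at hj ⊢
        omega
      rw [div_le_iff₀ h4, mul_sub, div_mul_cancel₀ _ (hSpos nstar hn1 hn2).ne'] at h3
      linarith
  obtain ⟨μ, hμ, hout, hmin⟩ := exists_minimizer N s a (fun V => by
    rw [ha]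
    exact mul_nonneg hβpos.le (pow_nonneg (by linarith) _))
  refine ⟨μ, hμ, le_antisymm ?_ (hlower μ hμ)⟩
  set x : ℕ → ℝ := fun k => ∑ W ∈ (Finset.Icc 1 N).powerset, μ k W with hx
  set t : ℝ := compTime N hN s μ with ht
  obtain ⟨n0, hn0, hn0t⟩ := Finset.exists_mem_eq_sup' (Finset.nonempty_Icc.mpr hN)
    (fun n => (∑ V ∈ (Finset.Icc 1 N).powerset, μ n V) / s n)
  have hmax : ∀ n ∈ Finset.Icc 1 N, x n / s n ≤ t := fun n hn =>
    Finset.le_sup' (fun n => (∑ V ∈ (Finset.Icc 1 N).powerset, μ n V) / s n) hn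
  set A : Finset ℕ := (Finset.Icc 1 N).filter (fun n => x n / s n = t) with hA
  have hAsub : A ⊆ Finset.Icc 1 N := Finset.filter_subset _ _
  have hn0A : n0 ∈ A := Finset.mem_filter.mpr ⟨hn0, hn0t.symm⟩
  have hxA : ∀ n ∈ A, x n = ∑ V ∈ A.powerset, μ n V := by
    intro n hn
    symm
    refine Finset.sum_subset (Finset.powerset_mono.mpr hAsub) ?_
    intro V hV hVA
    rw [Finset.mem_powerset] at hV hVA
    by_contra hne
    have hpos : 0 < μ n V := lt_of_le_of_ne (hμ.1 n V) (Ne.symm hne)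
    have hnV : n ∈ V := by
      by_contra h
      exact hne (hμ.2.1 n V h)
    refine hVA fun m hm => Finset.mem_filter.mpr ⟨hV hm, le_antisymm (hmax m (hV hm)) ?_⟩
    rw [← (Finset.mem_filter.mp hn).2]
    exact balanced hs_pos hμ hout hmin hV hnV hm hpos
  have hsumA : ∑ n ∈ A, x n = L A.card := by
    rw [hL, ← total_load ha hμ A hAsub]
    exact Finset.sum_congr rfl hxA
  have hsumA2 : ∑ n ∈ A, x n = t * ∑ n ∈ A, s n := by
    rw [Finset.mul_sum]
    refine Finset.sum_congr rfl fun n hn => ?_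
    rw [← (Finset.mem_filter.mp hn).2, div_mul_cancel₀ _ (hs_pos n (hAsub hn)).ne']
  have hcard1 : 1 ≤ A.card := Finset.card_pos.mpr ⟨n0, hn0A⟩
  have hcard2 : A.card ≤ N := by
    have := Finset.card_le_card hAsub
    rwa [Nat.card_Icc, Nat.add_sub_cancel] at this
  have hsA : 0 < ∑ n ∈ A, s n := Finset.sum_pos (fun n hn => hs_pos n (hAsub hn)) ⟨n0, hn0A⟩
  have hc : 0 ≤ L nstar / S nstar := by
    refine div_nonneg ?_ (hSpos nstar hn1 hn2).le
    rw [hL]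
    exact mul_nonneg hβpos.le (sub_nonneg.mpr (one_le_pow₀ hα.le))
  have hSA : S A.card ≤ ∑ n ∈ A, s n := by
    rw [hS]
    exact sum_speed_le hs_mono A hAsub
  refine le_of_mul_le_mul_right ?_ hsA
  rw [← hsumA2, hsumA]
  exact (hLS _ hcard1 hcard2).trans (mul_le_mul_of_nonneg_left hSA hc)
end

section
/- There exists an index n* ∈ {1,…,N} that satisfies both condition (10b) and condition (10c). -/
open Finset

/-- There exists an index `n* ∈ {1,…,N}` satisfying both condition (10b):
`L n* / S n* ≥ (L n − L n*)/(S n − S n*)` for all `n ∈ {n*+1,…,N}`,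
and condition (10c): `L n* / S n* ≥ L n / S n` for all `n ∈ {1,…,n*−1}`. -/
theorem exists_nstar
    (N : ℕ) (hN : 1 ≤ N) (α β : ℝ) (hα : 1 < α) (hβ : β = (α ^ N)⁻¹)
    (s : ℕ → ℝ) (hs_pos : ∀ i ∈ Finset.Icc 1 N, 0 < s i)
    (hs_mono : ∀ i j : ℕ, 1 ≤ i → i ≤ j → j ≤ N → s i ≤ s j)
    (L S : ℕ → ℝ) (hL : ∀ n, L n = β * (α ^ n - 1))
    (hS : ∀ n, S n = ∑ i ∈ Finset.Icc 1 n, s i) :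
    ∃ nstar : ℕ, 1 ≤ nstar ∧ nstar ≤ N ∧
      (∀ n, nstar < n → n ≤ N →
        (L n - L nstar) / (S n - S nstar) ≤ L nstar / S nstar) ∧
      (∀ n, 1 ≤ n → n < nstar → L n / S n ≤ L nstar / S nstar) := by
  obtain ⟨m, hm, hmax⟩ := Finset.exists_max_image (Finset.Icc 1 N) (fun n => L n / S n)
    ⟨1, Finset.mem_Icc.2 ⟨le_refl 1, hN⟩⟩
  obtain ⟨hm1, hmN⟩ := Finset.mem_Icc.1 hm
  have hSpos : ∀ n, 1 ≤ n → n ≤ N → 0 < S n := by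
    intro n h1 h2
    rw [hS]
    apply Finset.sum_pos
    · intro i hi
      have := Finset.mem_Icc.1 hi
      exact hs_pos i (Finset.mem_Icc.2 ⟨this.1, this.2.trans h2⟩)
    · exact ⟨1, Finset.mem_Icc.2 ⟨le_refl 1, h1⟩⟩
  refine ⟨m, hm1, hmN, ?_, ?_⟩
  · intro n hn hnN
    have hlt : S m < S n := by
      rw [hS, hS]
      apply Finset.sum_lt_sum_of_subset (i := n)
      · exact Finset.Icc_subset_Icc_right hn.le
      · exact Finset.mem_Icc.2 ⟨by omega, le_refl n⟩
      · simp only [Finset.mem_Icc]; omega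
      · exact hs_pos n (Finset.mem_Icc.2 ⟨by omega, hnN⟩)
      · intro j hj _
        have := Finset.mem_Icc.1 hj
        exact (hs_pos j (Finset.mem_Icc.2 ⟨this.1, this.2.trans hnN⟩)).le
    have h := hmax n (Finset.mem_Icc.2 ⟨by omega, hnN⟩)
    rw [div_le_iff₀ (hSpos n (by omega) hnN)] at h
    rw [div_le_iff₀ (sub_pos.2 hlt), mul_sub, div_mul_cancel₀ _ (hSpos m hm1 hmN).ne']
    linarith
  · intro n h1 hn
    exact hmax n (Finset.mem_Icc.2 ⟨h1, by omega⟩)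
end

section
/- For every feasible computation assignment μ and every nonempty subset T of {1,…,N}, the computation time satisfies c(μ) ≥ (Σ_{∅≠V⊆T} a(V)) / (Σ_{i∈T} s_i); in particular, taking T = {1,…,n}, c(μ) ≥ L_n / S_n for every n ∈ {1,…,N} when the loads are a(V) = β·(α−1)^{|V|} with β = α^(−N), where L_n = β·(α^n − 1) and S_n = s_1+…+s_n. -/
open Finset

/-- Cut-set converse bound: for every feasible assignment `μ` and every nonempty
cut `T ⊆ {1,…,N}`, the computation time is at least the total load stored only
within `T` divided by the total speed of `T`.  In particular, with the
decentralized loads `a V = β (α−1)^{|V|}` (`β = α^{−N}`), taking `T = {1,…,n}`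
gives `c(μ) ≥ L n / S n` for all `n ∈ {1,…,N}`. -/
theorem cutset_converse
    (N : ℕ) (hN : 1 ≤ N) (s : ℕ → ℝ) (hs_pos : ∀ i ∈ Finset.Icc 1 N, 0 < s i)
    (a : Finset ℕ → ℝ) (ha_nonneg : ∀ V, 0 ≤ a V)
    (μ : ℕ → Finset ℕ → ℝ) (hμ : Feasible N a μ) :
    (∀ T : Finset ℕ, T ⊆ Finset.Icc 1 N → T.Nonempty →
      (∑ V ∈ T.powerset.filter (fun V => V.Nonempty), a V) / (∑ i ∈ T, s i) ≤
        compTime N hN s μ) ∧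
    (∀ α β : ℝ, 1 < α → β = (α ^ N)⁻¹ →
      (∀ V : Finset ℕ, a V = β * (α - 1) ^ V.card) →
      ∀ n : ℕ, 1 ≤ n → n ≤ N →
        (β * (α ^ n - 1)) / (∑ i ∈ Finset.Icc 1 n, s i) ≤ compTime N hN s μ) := by
  obtain ⟨h0, h1, h2⟩ := hμ
  have key : ∀ T : Finset ℕ, T ⊆ Finset.Icc 1 N → T.Nonempty →
      (∑ V ∈ T.powerset.filter (fun V => V.Nonempty), a V) / (∑ i ∈ T, s i) ≤
        compTime N hN s μ := by
    intro T hT hTn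
    have hpos : 0 < ∑ i ∈ T, s i := Finset.sum_pos (fun i hi => hs_pos i (hT hi)) hTn
    rw [div_le_iff₀ hpos]
    calc ∑ V ∈ T.powerset.filter (fun V => V.Nonempty), a V
        = ∑ V ∈ T.powerset.filter (fun V => V.Nonempty), ∑ n ∈ T, μ n V := by
          refine Finset.sum_congr rfl fun V hV => ?_
          rw [Finset.mem_filter, Finset.mem_powerset] at hV
          rw [← h2 V (hV.1.trans hT) hV.2]
          exact Finset.sum_subset hV.1 fun n _ hn => h1 n V hn
      _ = ∑ n ∈ T, ∑ V ∈ T.powerset.filter (fun V => V.Nonempty), μ n V := Finset.sum_comm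
      _ ≤ ∑ n ∈ T, compTime N hN s μ * s n := by
          refine Finset.sum_le_sum fun n hn => ?_
          have hc : (∑ V ∈ (Finset.Icc 1 N).powerset, μ n V) / s n ≤ compTime N hN s μ :=
            Finset.le_sup' (fun n => (∑ V ∈ (Finset.Icc 1 N).powerset, μ n V) / s n) (hT hn)
          rw [div_le_iff₀ (hs_pos n (hT hn))] at hc
          refine le_trans ?_ hc
          refine Finset.sum_le_sum_of_subset_of_nonneg ?_ fun V _ _ => h0 n V
          exact (Finset.filter_subset _ _).trans (Finset.powerset_mono.mpr hT)
      _ = compTime N hN s μ * ∑ i ∈ T, s i := by rw [Finset.mul_sum]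
  refine ⟨key, ?_⟩
  intro α β _ _ hA n hn hnN
  have hk := key (Finset.Icc 1 n) (Finset.Icc_subset_Icc_right hnN) (Finset.nonempty_Icc.mpr hn)
  have hsum : ∑ V ∈ (Finset.Icc 1 n).powerset.filter (fun V => V.Nonempty), a V
      = β * (α ^ n - 1) := by
    have hfil : (Finset.Icc 1 n).powerset.filter (fun V => V.Nonempty)
        = (Finset.Icc 1 n).powerset.erase ∅ := by
      ext V
      simp [Finset.nonempty_iff_ne_empty, and_comm]
    have hp := Finset.sum_pow_mul_eq_add_pow (α - 1) 1 (Finset.Icc 1 n)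
    simp only [one_pow, mul_one, sub_add_cancel, Nat.card_Icc, Nat.add_sub_cancel] at hp
    rw [hfil, Finset.sum_erase_eq_sub (Finset.empty_mem_powerset _)]
    simp only [hA, ← Finset.mul_sum, hp]
    simp
    ring
  rwa [hsum] at hk
end

section
/- Suppose n* ∈ {1,…,N} satisfies conditions (10b) and (10c). Then there exists a feasible computation assignment μ whose computation time equals c(μ) = L_{n*}/S_{n*}. -/
open Finset

/-- total load of worker n -/
noncomputable def wload (N : ℕ) (μ : ℕ → Finset ℕ → ℝ) (n : ℕ) : ℝ :=
  ∑ V ∈ (Finset.Icc 1 N).powerset, μ n V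

def admis (N : ℕ) (a : Finset ℕ → ℝ) : Set (ℕ → Finset ℕ → ℝ) :=
  {μ | (∀ n V, 0 ≤ μ n V) ∧ (∀ n V, ¬ (n ∈ V ∧ V ⊆ Finset.Icc 1 N) → μ n V = 0) ∧
    (∀ V : Finset ℕ, V ⊆ Finset.Icc 1 N → V.Nonempty → ∑ n ∈ V, μ n V = a V)}

lemma admis_compact (N : ℕ) (a : Finset ℕ → ℝ) : IsCompact (admis N a) := by
  have hbox : IsCompact (Set.pi Set.univ (fun _ : ℕ => Set.pi Set.univ
      (fun V : Finset ℕ => Set.Icc (0:ℝ) (max (a V) 0)))) :=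
    isCompact_univ_pi fun _ => isCompact_univ_pi fun _ => isCompact_Icc
  refine hbox.of_isClosed_subset ?_ ?_
  · have e : admis N a = (⋂ n, ⋂ V, {μ : ℕ → Finset ℕ → ℝ | 0 ≤ μ n V}) ∩
        ((⋂ n, ⋂ V, ⋂ (_ : ¬ (n ∈ V ∧ V ⊆ Finset.Icc 1 N)), {μ | μ n V = 0}) ∩
        (⋂ V : Finset ℕ, ⋂ (_ : V ⊆ Finset.Icc 1 N), ⋂ (_ : V.Nonempty),
          {μ | ∑ n ∈ V, μ n V = a V})) := by
      ext μ
      simp only [admis, Set.mem_ofPred_eq, Set.mem_inter_iff, Set.mem_iInter]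
    rw [e]
    refine IsClosed.inter ?_ (IsClosed.inter ?_ ?_)
    · exact isClosed_iInter fun n => isClosed_iInter fun V =>
        isClosed_le continuous_const (by fun_prop)
    · exact isClosed_iInter fun n => isClosed_iInter fun V => isClosed_iInter fun _ =>
        isClosed_eq (by fun_prop) continuous_const
    · exact isClosed_iInter fun V => isClosed_iInter fun _ => isClosed_iInter fun _ =>
        isClosed_eq (by fun_prop) continuous_const
  · rintro μ ⟨h0, hz, hs⟩ n - V -
    refine ⟨h0 n V, ?_⟩
    by_cases h : n ∈ V ∧ V ⊆ Finset.Icc 1 N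
    · have := hs V h.2 ⟨n, h.1⟩
      rw [← this]
      exact le_max_of_le_left (Finset.single_le_sum (f := fun n => μ n V)
        (fun i _ => h0 i V) h.1)
    · rw [hz n V h]; exact le_max_right _ _

lemma admis_nonempty (N : ℕ) (a : Finset ℕ → ℝ) (ha : ∀ V, 0 ≤ a V) : (admis N a).Nonempty := by
  refine ⟨fun n V => if n ∈ V ∧ V ⊆ Finset.Icc 1 N then a V / V.card else 0, ?_, ?_, ?_⟩
  · intro n V
    have := ha V
    dsimp only
    split_ifs
    · positivity
    · exact le_rfl
  · intro n V h
    exact if_neg h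
  · intro V hV hne
    have : (V.card : ℝ) ≠ 0 := by
      exact_mod_cast hne.card_pos.ne'
    rw [Finset.sum_congr rfl (g := fun _ => a V / V.card)]
    · rw [Finset.sum_const, nsmul_eq_mul]; field_simp
    · intro n hn
      exact if_pos ⟨hn, hV⟩

lemma shift_mem {N : ℕ} {a : Finset ℕ → ℝ} {μ : ℕ → Finset ℕ → ℝ} (hμ : μ ∈ admis N a)
    {n m : ℕ} {V : Finset ℕ} (hn : n ∈ V) (hm : m ∈ V) (hV : V ⊆ Finset.Icc 1 N)
    {ε : ℝ} (hε : 0 ≤ ε) (hε' : ε ≤ μ n V) :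
    (fun i W => μ i W + (if W = V then (if i = m then ε else 0) - (if i = n then ε else 0) else 0))
      ∈ admis N a := by
  obtain ⟨h0, hz, hs⟩ := hμ
  refine ⟨?_, ?_, ?_⟩
  · intro i W
    have := h0 i W
    dsimp only
    split_ifs with h1 h2 h3 h3
    · linarith
    · linarith
    · subst h1 h3; linarith
    · linarith
    · linarith
  · intro i W h
    dsimp only
    rw [hz i W h]
    by_cases h1 : W = V
    · subst h1
      have hi : i ∉ W := fun hi => h ⟨hi, hV⟩
      have e1 : i ≠ m := fun e => hi (e ▸ hm)
      have e2 : i ≠ n := fun e => hi (e ▸ hn)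
      simp [e1, e2]
    · simp [h1]
  · intro W hW hne
    rw [Finset.sum_add_distrib, hs W hW hne]
    by_cases h1 : W = V
    · subst h1
      simp [Finset.sum_sub_distrib, hn, hm]
    · simp [h1]

lemma shift_load {N : ℕ} {μ : ℕ → Finset ℕ → ℝ}
    {n m : ℕ} {V : Finset ℕ} (hV : V ⊆ Finset.Icc 1 N) (ε : ℝ) (i : ℕ) :
    wload N (fun i W => μ i W + (if W = V then (if i = m then ε else 0) -
      (if i = n then ε else 0) else 0)) i
      = wload N μ i + ((if i = m then ε else 0) - (if i = n then ε else 0)) := by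
  unfold wload
  rw [Finset.sum_add_distrib, Finset.sum_ite_eq', if_pos (Finset.mem_powerset.2 hV)]

lemma exists_opt (N : ℕ) (a : Finset ℕ → ℝ) (ha : ∀ V, 0 ≤ a V)
    (s : ℕ → ℝ) (hs_pos : ∀ i ∈ Finset.Icc 1 N, 0 < s i) :
    ∃ μ ∈ admis N a, ∀ n m V, n ∈ V → m ∈ V → V ⊆ Finset.Icc 1 N →
      wload N μ m / s m < wload N μ n / s n → μ n V = 0 := by
  have hc : Continuous (fun μ : ℕ → Finset ℕ → ℝ =>
      ∑ i ∈ Finset.Icc 1 N, (wload N μ i) ^ 2 / s i) := by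
    unfold wload
    fun_prop
  obtain ⟨μ, hμ, hmin⟩ := (admis_compact N a).exists_isMinOn (admis_nonempty N a ha)
    hc.continuousOn
  refine ⟨μ, hμ, ?_⟩
  intro n m V hn hm hV hlt
  by_contra hne
  have hpos : 0 < μ n V := lt_of_le_of_ne (hμ.1 n V) (Ne.symm hne)
  have hsn := hs_pos n (hV hn)
  have hsm := hs_pos m (hV hm)
  have hnm : n ≠ m := by rintro rfl; exact lt_irrefl _ hlt
  set d := wload N μ n / s n - wload N μ m / s m with hd
  have hdpos : 0 < d := sub_pos.2 hlt
  set k := 1 / s n + 1 / s m with hk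
  have hkpos : 0 < k := by positivity
  set ε := min (μ n V) (d / k) with hεd
  have hε : 0 < ε := lt_min hpos (by positivity)
  have hεk : ε * k ≤ d := by
    have : ε ≤ d / k := min_le_right _ _
    rwa [le_div_iff₀ hkpos] at this
  have hmem := shift_mem hμ hn hm hV hε.le (min_le_left _ _)
  have hle := hmin hmem
  simp only [Set.mem_ofPred_eq, shift_load hV] at hle
  have hpt : ∀ i ∈ Finset.Icc 1 N,
      (wload N μ i + ((if i = m then ε else 0) - (if i = n then ε else 0))) ^ 2 / s i
      = wload N μ i ^ 2 / s i + (if i = m then (2 * ε * wload N μ m + ε ^ 2) / s m else 0)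
        + (if i = n then (-2 * ε * wload N μ n + ε ^ 2) / s n else 0) := by
    intro i _
    by_cases h1 : i = m
    · subst h1
      simp only [if_true, if_neg hnm.symm]
      ring
    · by_cases h2 : i = n
      · subst h2
        simp only [if_true, if_neg h1]
        ring
      · simp [h1, h2]
  rw [Finset.sum_congr rfl hpt, Finset.sum_add_distrib, Finset.sum_add_distrib,
    Finset.sum_ite_eq', Finset.sum_ite_eq', if_pos (hV hn), if_pos (hV hm)] at hle
  have : (2 * ε * wload N μ m + ε ^ 2) / s m + (-2 * ε * wload N μ n + ε ^ 2) / s n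
      = ε * (ε * k - 2 * d) := by
    rw [hk, hd]; ring
  nlinarith [mul_pos hε hdpos]

lemma sum_sub {N : ℕ} {α β : ℝ} {a : Finset ℕ → ℝ}
    (ha : ∀ V : Finset ℕ, a V = β * (α - 1) ^ V.card)
    {μ : ℕ → Finset ℕ → ℝ} (hμ : μ ∈ admis N a) {T : Finset ℕ} (hT : T ⊆ Finset.Icc 1 N) :
    ∑ V ∈ T.powerset, ∑ n ∈ V, μ n V = β * (α ^ T.card - 1) := by
  have h1 : ∑ V ∈ T.powerset, (α - 1) ^ V.card = α ^ T.card := by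
    have := Finset.sum_pow_mul_eq_add_pow (α - 1) 1 T
    simpa using this
  have h2 : ∀ V ∈ T.powerset, ∑ n ∈ V, μ n V =
      β * (α - 1) ^ V.card - (if V = ∅ then β else 0) := by
    intro V hV
    rcases V.eq_empty_or_nonempty with rfl | hne
    · simp
    · rw [if_neg hne.ne_empty, hμ.2.2 V ((Finset.mem_powerset.1 hV).trans hT) hne, ha]; simp
  rw [Finset.sum_congr rfl h2, Finset.sum_sub_distrib, ← Finset.mul_sum, h1,
    Finset.sum_ite_eq', if_pos (Finset.empty_mem_powerset T)]
  ring

lemma speed_le (N : ℕ) (s : ℕ → ℝ)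
    (hs_mono : ∀ i j : ℕ, 1 ≤ i → i ≤ j → j ≤ N → s i ≤ s j) (T : Finset ℕ) :
    T ⊆ Finset.Icc 1 N → ∑ i ∈ Finset.Icc 1 T.card, s i ≤ ∑ i ∈ T, s i := by
  induction T using Finset.induction_on_max with
  | empty => simp
  | insert m T hm ih =>
    intro hT
    have hmT : m ∉ T := fun h => lt_irrefl _ (hm m h)
    have hTN : T ⊆ Finset.Icc 1 N := (Finset.subset_insert _ _).trans hT
    have hmN := Finset.mem_Icc.1 (hT (Finset.mem_insert_self m T))
    have hcard : T.card + 1 ≤ m := by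
      have : T ⊆ Finset.Ico 1 m := fun x hx =>
        Finset.mem_Ico.2 ⟨(Finset.mem_Icc.1 (hTN hx)).1, hm x hx⟩
      have := Finset.card_le_card this
      rw [Nat.card_Ico] at this
      omega
    rw [Finset.card_insert_of_notMem hmT, Finset.sum_insert hmT,
      Finset.sum_Icc_succ_top (by omega)]
    have := ih hTN
    have := hs_mono (T.card + 1) m (by omega) hcard hmN.2
    linarith

/-- Achievability: if `n*` satisfies conditions (10b) and (10c), then there is a
feasible computation assignment whose computation time equals `L n* / S n*`. -/
theorem achievability
    (N : ℕ) (hN : 1 ≤ N) (α β : ℝ) (hα : 1 < α) (hβ : β = (α ^ N)⁻¹)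
    (s : ℕ → ℝ) (hs_pos : ∀ i ∈ Finset.Icc 1 N, 0 < s i)
    (hs_mono : ∀ i j : ℕ, 1 ≤ i → i ≤ j → j ≤ N → s i ≤ s j)
    (a : Finset ℕ → ℝ) (ha : ∀ V : Finset ℕ, a V = β * (α - 1) ^ V.card)
    (L S : ℕ → ℝ) (hL : ∀ n, L n = β * (α ^ n - 1))
    (hS : ∀ n, S n = ∑ i ∈ Finset.Icc 1 n, s i)
    (nstar : ℕ) (hn1 : 1 ≤ nstar) (hn2 : nstar ≤ N)
    (h10b : ∀ n, nstar < n → n ≤ N →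
      (L n - L nstar) / (S n - S nstar) ≤ L nstar / S nstar)
    (h10c : ∀ n, 1 ≤ n → n < nstar → L n / S n ≤ L nstar / S nstar) :
    ∃ μ : ℕ → Finset ℕ → ℝ, Feasible N a μ ∧
      compTime N hN s μ = L nstar / S nstar := by
  have hβ0 : 0 < β := by rw [hβ]; positivity
  have ha0 : ∀ V, 0 ≤ a V := by
    intro V
    rw [ha]
    have : 0 < α - 1 := by linarith
    positivity
  have hSpos : ∀ n, 1 ≤ n → n ≤ N → 0 < S n := by
    intro n h1 h2
    rw [hS]
    exact Finset.sum_pos (fun i hi => hs_pos i (Finset.Icc_subset_Icc_right h2 hi))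
      (Finset.nonempty_Icc.2 h1)
  set c := L nstar / S nstar with hc
  have hSst := hSpos nstar hn1 hn2
  have hLst : L nstar = c * S nstar := by rw [hc]; field_simp
  have hLc : ∀ n, 1 ≤ n → n ≤ N → L n ≤ c * S n := by
    intro n h1 h2
    rcases lt_trichotomy n nstar with h | h | h
    · have := h10c n h1 h
      rwa [div_le_iff₀ (hSpos n h1 h2)] at this
    · rw [h, hLst]
    · have hlt : 0 < S n - S nstar := by
        rw [hS, hS, sub_pos]
        refine Finset.sum_lt_sum_of_subset (i := n) (Finset.Icc_subset_Icc_right h.le)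
          (by simp [h1]) (by simp [h]) (hs_pos n (by simp [h1, h2])) ?_
        intro j hj _
        exact (hs_pos j (Finset.Icc_subset_Icc_right h2 hj)).le
      have := h10b n h h2
      rw [div_le_iff₀ hlt] at this
      nlinarith
  obtain ⟨μ, hμ, hopt⟩ := exists_opt N a ha0 s hs_pos
  refine ⟨μ, ⟨hμ.1, fun n V h => hμ.2.1 n V (fun h' => h h'.1), hμ.2.2⟩, ?_⟩
  have hctdef : compTime N hN s μ = (Finset.Icc 1 N).sup' (Finset.nonempty_Icc.mpr hN)
    (fun n => wload N μ n / s n) := rfl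
  set M := compTime N hN s μ with hM
  have hMle : ∀ n ∈ Finset.Icc 1 N, wload N μ n / s n ≤ M := by
    intro n hn
    rw [hctdef]
    exact Finset.le_sup' (fun n => wload N μ n / s n) hn
  have hswap : ∀ T : Finset ℕ, ∑ n ∈ T, wload N μ n =
      ∑ V ∈ (Finset.Icc 1 N).powerset, ∑ n ∈ T, μ n V := by
    intro T
    unfold wload
    exact Finset.sum_comm
  have hin : ∀ T V : Finset ℕ, V ⊆ T → ∑ n ∈ V, μ n V = ∑ n ∈ T, μ n V := by
    intro T V hVT
    exact Finset.sum_subset hVT fun x _ hx => hμ.2.1 x V fun h => hx h.1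
  apply le_antisymm
  · set T := (Finset.Icc 1 N).filter (fun n => wload N μ n / s n = M) with hT
    have hTN : T ⊆ Finset.Icc 1 N := Finset.filter_subset _ _
    have hTne : T.Nonempty := by
      obtain ⟨n, hn, hne⟩ := Finset.exists_mem_eq_sup' (Finset.nonempty_Icc.mpr hN)
        (fun n => wload N μ n / s n)
      exact ⟨n, Finset.mem_filter.2 ⟨hn, by rw [hctdef]; exact hne.symm⟩⟩
    have hload : ∑ n ∈ T, wload N μ n = L T.card := by
      rw [hswap, hL, ← sum_sub ha hμ hTN]
      symm
      rw [Finset.sum_congr rfl (fun V hV => hin T V (Finset.mem_powerset.1 hV))]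
      refine Finset.sum_subset (Finset.powerset_mono.2 hTN) ?_
      intro V hV hVT
      refine Finset.sum_eq_zero ?_
      intro n hn
      by_cases hnV : n ∈ V
      · rw [Finset.mem_powerset, Finset.not_subset] at hVT
        obtain ⟨m, hmV, hmT⟩ := hVT
        have hVN := Finset.mem_powerset.1 hV
        refine hopt n m V hnV hmV hVN ?_
        rw [(Finset.mem_filter.1 hn).2]
        exact lt_of_le_of_ne (hMle m (hVN hmV))
          fun h => hmT (Finset.mem_filter.2 ⟨hVN hmV, h⟩)
      · exact hμ.2.1 n V fun h => hnV h.1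
    have hload2 : ∑ n ∈ T, wload N μ n = M * ∑ n ∈ T, s n := by
      rw [Finset.mul_sum]
      refine Finset.sum_congr rfl fun n hn => ?_
      have h1 := hs_pos n (hTN hn)
      rw [← (Finset.mem_filter.1 hn).2]
      field_simp
    have hc1 : 1 ≤ T.card := hTne.card_pos
    have hc2 : T.card ≤ N := by simpa using Finset.card_le_card hTN
    have h1 := hLc T.card hc1 hc2
    have h2 := speed_le N s hs_mono T hTN
    rw [← hS] at h2
    have h3 := hSpos T.card hc1 hc2
    have hLn : 0 ≤ L nstar := by
      rw [hL]
      have : 1 ≤ α ^ nstar := one_le_pow₀ hα.le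
      exact mul_nonneg hβ0.le (by linarith)
    have hc0 : 0 ≤ c := div_nonneg hLn hSst.le
    have h4 : c * S T.card ≤ c * ∑ n ∈ T, s n := mul_le_mul_of_nonneg_left h2 hc0
    exact le_of_mul_le_mul_right (by linarith) (lt_of_lt_of_le h3 h2)
  · have hTN : Finset.Icc 1 nstar ⊆ Finset.Icc 1 N := Finset.Icc_subset_Icc_right hn2
    have h1 : L nstar ≤ ∑ n ∈ Finset.Icc 1 nstar, wload N μ n := by
      have := sum_sub ha hμ hTN
      rw [Nat.card_Icc, Nat.add_sub_cancel, ← hL] at this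
      rw [hswap, ← this,
        Finset.sum_congr rfl (fun V hV => hin _ V (Finset.mem_powerset.1 hV))]
      exact Finset.sum_le_sum_of_subset_of_nonneg (Finset.powerset_mono.2 hTN)
        fun V _ _ => Finset.sum_nonneg fun n _ => hμ.1 n V
    have h2 : ∑ n ∈ Finset.Icc 1 nstar, wload N μ n ≤ M * S nstar := by
      rw [hS, Finset.mul_sum]
      refine Finset.sum_le_sum fun n hn => ?_
      have := hMle n (hTN hn)
      rwa [div_le_iff₀ (hs_pos n (hTN hn))] at this
    rw [hc, div_le_iff₀ hSst]
    linarith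
end

section
/- Suppose n* ∈ {1,…,N} satisfies conditions (10b) and (10c). Then L_{n*}/S_{n*} = max_{n∈{1,…,N}} L_n/S_n. -/
open Finset

/-- If `n* ∈ {1,…,N}` satisfies conditions (10b) and (10c), then
`L n* / S n*` equals the maximum of `L n / S n` over `n ∈ {1,…,N}`. -/
theorem nstar_is_max
    (N : ℕ) (hN : 1 ≤ N) (α β : ℝ) (hα : 1 < α) (hβ : β = (α ^ N)⁻¹)
    (s : ℕ → ℝ) (hs_pos : ∀ i ∈ Finset.Icc 1 N, 0 < s i)
    (L S : ℕ → ℝ) (hL : ∀ n, L n = β * (α ^ n - 1))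
    (hS : ∀ n, S n = ∑ i ∈ Finset.Icc 1 n, s i)
    (nstar : ℕ) (hn1 : 1 ≤ nstar) (hn2 : nstar ≤ N)
    (h10b : ∀ n, nstar < n → n ≤ N →
      (L n - L nstar) / (S n - S nstar) ≤ L nstar / S nstar)
    (h10c : ∀ n, 1 ≤ n → n < nstar → L n / S n ≤ L nstar / S nstar) :
    L nstar / S nstar =
      (Finset.Icc 1 N).sup' (Finset.nonempty_Icc.mpr hN) (fun n => L n / S n) := by
  have hpos : ∀ n, 1 ≤ n → n ≤ N → 0 < S n := by
    intro n h1 h2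
    rw [hS]
    apply Finset.sum_pos
    · intro i hi
      rw [Finset.mem_Icc] at hi
      exact hs_pos i (Finset.mem_Icc.mpr ⟨hi.1, hi.2.trans h2⟩)
    · exact Finset.nonempty_Icc.mpr h1
  have hmono : ∀ n, nstar < n → n ≤ N → S nstar < S n := by
    intro n h1 h2
    rw [hS, hS]
    apply Finset.sum_lt_sum_of_subset (i := n)
    · exact Finset.Icc_subset_Icc_right h1.le
    · exact Finset.mem_Icc.mpr ⟨by omega, le_rfl⟩
    · simp [Finset.mem_Icc]; omega
    · exact hs_pos n (Finset.mem_Icc.mpr ⟨by omega, h2⟩)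
    · intro j hj _
      rw [Finset.mem_Icc] at hj
      exact (hs_pos j (Finset.mem_Icc.mpr ⟨hj.1, hj.2.trans h2⟩)).le
  apply le_antisymm
  · exact Finset.le_sup' (fun n => L n / S n) (Finset.mem_Icc.mpr ⟨hn1, hn2⟩)
  · apply Finset.sup'_le
    intro n hn
    rw [Finset.mem_Icc] at hn
    rcases lt_trichotomy n nstar with h | h | h
    · exact h10c n hn.1 h
    · rw [h]
    · have hb := h10b n h hn.2
      have hm := hmono n h hn.2
      have hp := hpos nstar hn1 hn2
      have hp' := hpos n hn.1 hn.2
      rw [div_le_div_iff₀ (by linarith) hp] at hb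
      show L n / S n ≤ L nstar / S nstar
      rw [div_le_div_iff₀ hp' hp]
      nlinarith
end

section
/- For every real α ≥ 1 and all positive integers n and m, n·(α^{n+m} − 1) ≤ (n+m)·(α^{n+m} − α^m). -/
/-- For every real `α ≥ 1` and positive integers `n, m`,
`n (α^{n+m} − 1) ≤ (n+m)(α^{n+m} − α^m)`. -/
theorem load_rearrangement_ineq (α : ℝ) (hα : 1 ≤ α) (n m : ℕ)
    (hn : 0 < n) (hm : 0 < m) :
    (n : ℝ) * (α ^ (n + m) - 1) ≤ ((n : ℝ) + m) * (α ^ (n + m) - α ^ m) := by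
  have hA : (n : ℝ) * (α - 1) ≤ α ^ n - 1 := by
    have h := one_add_mul_le_pow (a := α - 1) (by linarith) n
    rw [add_sub_cancel] at h
    linarith
  have hB : ∀ k : ℕ, α ^ k - 1 ≤ (k : ℝ) * (α ^ k * (α - 1)) := by
    intro k
    induction k with
    | zero => simp
    | succ k ih =>
      have hp : (0 : ℝ) ≤ α ^ k := by positivity
      have h2 : 0 ≤ ((k : ℝ) + 1) * (α ^ k * ((α - 1) * (α - 1))) :=
        mul_nonneg (by positivity) (mul_nonneg hp (mul_self_nonneg _))
      push_cast
      rw [pow_succ]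
      linarith
  have h1 := mul_le_mul_of_nonneg_left (hB m) (Nat.cast_nonneg (α := ℝ) n)
  have h2 := mul_le_mul_of_nonneg_left hA
    (show (0 : ℝ) ≤ m * α ^ m by positivity)
  rw [pow_add]
  linarith
end
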